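/- Let π = {C₁, C₂, C₃, …, C_K} be a K-partition of V, let r₁ and r₂ be the smallest elements of C₁ and C₂, and let i ∈ C₁ ∖ {r₁} with i < r₂. Let π¹, π², π³, π⁴ be the K-partitions obtained from π by applying the transformations T(C₁,C₂,{r₁}), T(C₁,C₂,{i}), T(C₁,C₂,{r₁,r₂}), and T(C₁,C₂,{i,r₂}) respectively. If α ∈ ℝ^{|E|+n−3} and α₀ ∈ ℝ are such that the characteristic vectors of π, π¹, π², π³, π⁴ all satisfy α·x = α₀, then α_{r₁,r₂} = α_{r₂,i}. -/

import Mathlib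

/-- A `K`-partition of `V = {1,…,n}`: a family of `K` nonempty pairwise disjoint
subsets of `V` (clusters) whose union is `V`. -/
structure KPartition (n K : ℕ) where
  parts : Finset (Finset ℕ)
  card_parts : parts.card = K
  parts_nonempty : ∀ C ∈ parts, C.Nonempty
  parts_disjoint : ∀ C ∈ parts, ∀ D ∈ parts, C ≠ D → Disjoint C D
  parts_cover : parts.sup id = Finset.Icc 1 n

/-- The ambient space: one (symmetric) edge coordinate for each pair of vertices and one
representative coordinate for each vertex (only the coordinates of edges `uv ∈ E` and of
vertices `v ∈ {4,…,n}` are actually used; the remaining ones are affinely determined, so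
affine dimensions agree with those in `ℝ^{|E|+n-3}`). -/
abbrev GPoint : Type := (ℕ × ℕ → ℝ) × (ℕ → ℝ)

open Classical in
/-- The characteristic vector of a `K`-partition: edge component `x_{u,v} = 1` iff `u` and `v`
lie in the same cluster; representative component `x_v = 1` (for `v ∈ {4,…,n}`) iff `v` is the
smallest element of its cluster. -/
noncomputable def charVec (n K : ℕ) (π : KPartition n K) : GPoint :=
  ⟨fun p => if ∃ C ∈ π.parts, p.1 ∈ C ∧ p.2 ∈ C then 1 else 0,
   fun v => if 4 ≤ v ∧ ∃ C ∈ π.parts, v ∈ C ∧ ∀ w ∈ C, v ≤ w then 1 else 0⟩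

/-- `P_{n,K}`: the convex hull of the characteristic vectors of all `K`-partitions. -/
noncomputable def PolyP (n K : ℕ) : Set GPoint :=
  convexHull ℝ {x | ∃ π : KPartition n K, x = charVec n K π}

/-- Affine dimension of a set: the rank of the direction of its affine span. -/
noncomputable def adim (s : Set GPoint) : ℕ :=
  Module.finrank ℝ (affineSpan ℝ s).direction

/-- `f x ≤ b` is a valid inequality for `P_{n,K}` which is facet-defining. -/
def IsFacetLe (n K : ℕ) (f : GPoint → ℝ) (b : ℝ) : Prop :=
  (∀ x ∈ PolyP n K, f x ≤ b) ∧
  adim {x | x ∈ PolyP n K ∧ f x = b} + 1 = adim (PolyP n K)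

/-- `f x ≥ b` is a valid inequality for `P_{n,K}` which is facet-defining. -/
def IsFacetGe (n K : ℕ) (f : GPoint → ℝ) (b : ℝ) : Prop :=
  (∀ x ∈ PolyP n K, b ≤ f x) ∧
  adim {x | x ∈ PolyP n K ∧ f x = b} + 1 = adim (PolyP n K)

/-- Sum of the edge components of `x` over the edges with both endpoints in `A`. -/
noncomputable def edgeSum (A : Finset ℕ) (x : GPoint) : ℝ :=
  ∑ e ∈ A.offDiag.filter (fun e => e.1 < e.2), x.1 e

/-- The transformation `T(C₁,C₂,R)` on the clusters of a partition: the elements of `R`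
switch between `C₁` and `C₂`, all other clusters are unchanged. -/
def swapParts (parts : Finset (Finset ℕ)) (C₁ C₂ R : Finset ℕ) : Finset (Finset ℕ) :=
  insert ((C₁ \ R) ∪ (R ∩ C₂)) (insert ((C₂ \ R) ∪ (R ∩ C₁)) (parts \ {C₁, C₂}))

/-- The pairing `α·x = Σ_{uv ∈ E} α_{u,v} x_{u,v} + Σ_{v=4}^n α_v x_v`. -/
noncomputable def dotP (n : ℕ) (a x : GPoint) : ℝ :=
  (∑ e ∈ (Finset.Icc 1 n).offDiag.filter (fun e => e.1 < e.2), a.1 e * x.1 e) +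
    ∑ v ∈ Finset.Icc 4 n, a.2 v * x.2 v

/-- The representative coefficient `α_v`, with the convention `α_v = 0` for `v ∈ {1,2,3}`. -/
noncomputable def repCoef (a : GPoint) (v : ℕ) : ℝ :=
  if 4 ≤ v then a.2 v else 0

/-- A property holds for some cluster of `swapParts parts C₁ C₂ R` iff it holds for one of the two
new clusters or for one of the unchanged ones. -/
lemma exists_mem_swapParts (parts : Finset (Finset ℕ)) (C₁ C₂ R : Finset ℕ)
    (p : Finset ℕ → Prop) :
    (∃ C ∈ swapParts parts C₁ C₂ R, p C) ↔
      p ((C₁ \ R) ∪ (R ∩ C₂)) ∨ p ((C₂ \ R) ∪ (R ∩ C₁)) ∨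
        ∃ C ∈ parts \ {C₁, C₂}, p C := by
  simp only [swapParts, Finset.mem_insert, exists_eq_or_imp]

/-- When some `t < r₂` other than `s` stays in `C₁`, and `s < r₂ = min C₂`, switching `r₂` along
with `s` does not change the representatives. -/
lemma charVec_snd_swap_eq {n K : ℕ} {π σ τ : KPartition n K} {C₁ C₂ : Finset ℕ}
    (hdisj : Disjoint C₁ C₂) {s t r : ℕ} (hs : s ∈ C₁) (ht : t ∈ C₁) (hts : t ≠ s)
    (hrmin : ∀ w ∈ C₂, r ≤ w) (hsr : s < r) (htr : t < r)
    (hσ : σ.parts = swapParts π.parts C₁ C₂ {s})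
    (hτ : τ.parts = swapParts π.parts C₁ C₂ {s, r}) :
    (charVec n K σ).2 = (charVec n K τ).2 := by
  have hd : ∀ x ∈ C₁, x ∉ C₂ := fun x hx => Finset.disjoint_left.mp hdisj hx
  funext v
  simp only [charVec]
  refine if_congr (and_congr_right fun _ => ?_) rfl rfl
  rw [hσ, hτ, exists_mem_swapParts, exists_mem_swapParts]
  have hfst : (v ∈ (C₁ \ {s}) ∪ ({s} ∩ C₂) ∧ ∀ w ∈ (C₁ \ {s}) ∪ ({s} ∩ C₂), v ≤ w) ↔
      (v ∈ (C₁ \ {s, r}) ∪ ({s, r} ∩ C₂) ∧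
        ∀ w ∈ (C₁ \ {s, r}) ∪ ({s, r} ∩ C₂), v ≤ w) := by
    simp only [Finset.mem_union, Finset.mem_sdiff, Finset.mem_inter, Finset.mem_singleton,
      Finset.mem_insert]
    constructor
    · rintro ⟨hv, hm⟩
      have := hm t (by grind)
      exact ⟨by grind, fun w hw => by grind⟩
    · rintro ⟨hv, hm⟩
      have := hm t (by grind)
      exact ⟨by grind, fun w hw => by grind⟩
  have hsnd : (v ∈ (C₂ \ {s}) ∪ ({s} ∩ C₁) ∧ ∀ w ∈ (C₂ \ {s}) ∪ ({s} ∩ C₁), v ≤ w) ↔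
      (v ∈ (C₂ \ {s, r}) ∪ ({s, r} ∩ C₁) ∧
        ∀ w ∈ (C₂ \ {s, r}) ∪ ({s, r} ∩ C₁), v ≤ w) := by
    simp only [Finset.mem_union, Finset.mem_sdiff, Finset.mem_inter, Finset.mem_singleton,
      Finset.mem_insert]
    constructor
    · rintro ⟨hv, hm⟩
      have := hm s (by grind)
      exact ⟨by grind, fun w hw => by grind⟩
    · rintro ⟨hv, hm⟩
      have := hm s (by grind)
      exact ⟨by grind, fun w hw => by grind⟩
  rw [hfst, hsnd]

/-- Switching `r ∈ C₂` along with `s ∈ C₁` only changes the edges at `r`. -/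
lemma charVec_fst_swap_eq {n K : ℕ} {π σ τ : KPartition n K} {C₁ C₂ : Finset ℕ} {s r : ℕ}
    (hσ : σ.parts = swapParts π.parts C₁ C₂ {s})
    (hτ : τ.parts = swapParts π.parts C₁ C₂ {s, r}) {u v : ℕ} (hu : u ≠ r) (hv : v ≠ r) :
    (charVec n K σ).1 (u, v) = (charVec n K τ).1 (u, v) := by
  simp only [charVec]
  refine if_congr ?_ rfl rfl
  rw [hσ, hτ, exists_mem_swapParts, exists_mem_swapParts]
  simp [hu, hv]

/-- Edge components are symmetric. -/
lemma charVec_fst_comm {n K : ℕ} (π : KPartition n K) (u v : ℕ) :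
    (charVec n K π).1 (u, v) = (charVec n K π).1 (v, u) := by
  simp only [charVec]
  exact if_congr (by simp only [and_comm]) rfl rfl

/-- The edges at `r ∈ C₂` after `s ∈ C₁` is moved to `C₂`. -/
lemma charVec_fst_swap_singleton {n K : ℕ} {π σ : KPartition n K} {C₁ C₂ : Finset ℕ}
    (hC₁ : C₁ ∈ π.parts) (hC₂ : C₂ ∈ π.parts) (hne : C₁ ≠ C₂) {s r : ℕ} (hs : s ∈ C₁)
    (hr : r ∈ C₂) (hσ : σ.parts = swapParts π.parts C₁ C₂ {s}) (u : ℕ) :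
    (charVec n K σ).1 (u, r) = if u ∈ C₂ ∨ u = s then 1 else 0 := by
  have hd : ∀ x ∈ C₁, x ∉ C₂ :=
    fun x hx => Finset.disjoint_left.mp (π.parts_disjoint _ hC₁ _ hC₂ hne) hx
  have hrest : ¬ ∃ C ∈ π.parts \ {C₁, C₂}, u ∈ C ∧ r ∈ C := by
    rintro ⟨C, hC, -, hrC⟩
    simp only [Finset.mem_sdiff, Finset.mem_insert, Finset.mem_singleton, not_or] at hC
    exact Finset.disjoint_left.mp (π.parts_disjoint _ hC.1 _ hC₂ hC.2.2) hrC hr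
  simp only [charVec]
  refine if_congr ?_ rfl rfl
  rw [hσ, exists_mem_swapParts]
  simp only [Finset.mem_union, Finset.mem_sdiff, Finset.mem_inter,
    Finset.mem_singleton]
  grind

/-- The edges at `r ∈ C₂` after `r` and `s ∈ C₁` have been switched. -/
lemma charVec_fst_swap_pair {n K : ℕ} {π τ : KPartition n K} {C₁ C₂ : Finset ℕ}
    (hC₁ : C₁ ∈ π.parts) (hC₂ : C₂ ∈ π.parts) (hne : C₁ ≠ C₂) {s r : ℕ} (hs : s ∈ C₁)
    (hr : r ∈ C₂) (hτ : τ.parts = swapParts π.parts C₁ C₂ {s, r}) (u : ℕ) :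
    (charVec n K τ).1 (u, r) = if (u ∈ C₁ ∧ u ≠ s) ∨ u = r then 1 else 0 := by
  have hd : ∀ x ∈ C₁, x ∉ C₂ :=
    fun x hx => Finset.disjoint_left.mp (π.parts_disjoint _ hC₁ _ hC₂ hne) hx
  have hrest : ¬ ∃ C ∈ π.parts \ {C₁, C₂}, u ∈ C ∧ r ∈ C := by
    rintro ⟨C, hC, -, hrC⟩
    simp only [Finset.mem_sdiff, Finset.mem_insert, Finset.mem_singleton, not_or] at hC
    exact Finset.disjoint_left.mp (π.parts_disjoint _ hC.1 _ hC₂ hC.2.2) hrC hr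
  simp only [charVec]
  refine if_congr ?_ rfl rfl
  rw [hτ, exists_mem_swapParts]
  simp only [Finset.mem_union, Finset.mem_sdiff, Finset.mem_inter,
    Finset.mem_singleton, Finset.mem_insert]
  grind

/-- Every element of a cluster is a vertex. -/
lemma KPartition.mem_Icc {n K : ℕ} (π : KPartition n K) {C : Finset ℕ} (hC : C ∈ π.parts)
    {v : ℕ} (hv : v ∈ C) : v ∈ Finset.Icc 1 n := by
  rw [← π.parts_cover]
  exact Finset.le_sup (f := id) hC hv

/-- Lemma 4: with `i ∈ C₁ ∖ {r₁}` and `i < r₂`, if the characteristic vectors of `π` and of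
the partitions obtained by `T(C₁,C₂,{r₁})`, `T(C₁,C₂,{i})`, `T(C₁,C₂,{r₁,r₂})`,
`T(C₁,C₂,{i,r₂})` all lie on the hyperplane `α·x = α₀`, then `α_{r₁,r₂} = α_{r₂,i}`. -/
theorem lemma5 (n K : ℕ) (π π₁ π₂ π₃ π₄ : KPartition n K)
    (C₁ C₂ : Finset ℕ) (hC₁ : C₁ ∈ π.parts) (hC₂ : C₂ ∈ π.parts) (hCne : C₁ ≠ C₂)
    (r₁ r₂ i : ℕ)
    (hr₁ : r₁ ∈ C₁) (hr₁min : ∀ w ∈ C₁, r₁ ≤ w)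
    (hr₂ : r₂ ∈ C₂) (hr₂min : ∀ w ∈ C₂, r₂ ≤ w)
    (hi : i ∈ C₁) (hine : i ≠ r₁) (hir₂ : i < r₂)
    (h₁ : π₁.parts = swapParts π.parts C₁ C₂ {r₁})
    (h₂ : π₂.parts = swapParts π.parts C₁ C₂ {i})
    (h₃ : π₃.parts = swapParts π.parts C₁ C₂ {r₁, r₂})
    (h₄ : π₄.parts = swapParts π.parts C₁ C₂ {i, r₂})
    (a : GPoint) (hsym : ∀ u v, a.1 (u, v) = a.1 (v, u)) (a₀ : ℝ)
    (hπ : dotP n a (charVec n K π) = a₀)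
    (hπ₁ : dotP n a (charVec n K π₁) = a₀)
    (hπ₂ : dotP n a (charVec n K π₂) = a₀)
    (hπ₃ : dotP n a (charVec n K π₃) = a₀)
    (hπ₄ : dotP n a (charVec n K π₄) = a₀) :
    a.1 (r₁, r₂) = a.1 (r₂, i) := by
  have hdisj := π.parts_disjoint _ hC₁ _ hC₂ hCne
  have hd : ∀ x ∈ C₁, x ∉ C₂ := fun x hx => Finset.disjoint_left.mp hdisj hx
  have hr₁i : r₁ < i := lt_of_le_of_ne (hr₁min i hi) (Ne.symm hine)
  have hr₁r₂ : r₁ < r₂ := hr₁i.trans hir₂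
  have hrep₁₃ := charVec_snd_swap_eq hdisj hr₁ hi hine hr₂min hr₁r₂ hir₂ h₁ h₃
  have hrep₂₄ := charVec_snd_swap_eq hdisj hi hr₁ hine.symm hr₂min hir₂ hr₁r₂ h₂ h₄
  have hcoef : ∀ u v : ℕ, u < v →
      (charVec n K π₁).1 (u, v) - (charVec n K π₃).1 (u, v) - (charVec n K π₂).1 (u, v) +
        (charVec n K π₄).1 (u, v) =
      (if (u, v) = (r₁, r₂) then 2 else 0) - (if (u, v) = (i, r₂) then 2 else 0) := by
    have hat : ∀ u : ℕ,
        (charVec n K π₁).1 (u, r₂) - (charVec n K π₃).1 (u, r₂) - (charVec n K π₂).1 (u, r₂) +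
          (charVec n K π₄).1 (u, r₂) =
        (if u = r₁ then 2 else 0) - (if u = i then 2 else 0) := by
      intro u
      rw [charVec_fst_swap_singleton hC₁ hC₂ hCne hr₁ hr₂ h₁,
        charVec_fst_swap_singleton hC₁ hC₂ hCne hi hr₂ h₂,
        charVec_fst_swap_pair hC₁ hC₂ hCne hr₁ hr₂ h₃,
        charVec_fst_swap_pair hC₁ hC₂ hCne hi hr₂ h₄]
      have h₁₂ := hd r₁ hr₁
      have hi₂ := hd i hi
      by_cases hur : u = r₁
      · subst hur
        simp [hr₁, h₁₂, hine.symm, hr₁r₂.ne]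
        norm_num
      · by_cases hui : u = i
        · subst hui
          simp [hi, hi₂, hine, hir₂.ne]
          norm_num
        · simp [hur, hui]
    intro u v huv
    by_cases hv : v = r₂
    · subst hv
      simpa using hat u
    · by_cases hu : u = r₂
      · subst hu
        have h := hat v
        rw [if_neg (hr₁r₂.trans huv).ne', if_neg (hir₂.trans huv).ne'] at h
        simp only [charVec_fst_comm _ u v, h]
        simp [hv]
      · rw [charVec_fst_swap_eq h₁ h₃ hu hv, charVec_fst_swap_eq h₂ h₄ hu hv]
        simp [hv]
  set E := (Finset.Icc 1 n).offDiag.filter (fun e => e.1 < e.2) with hE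
  have hmem : ∀ u ∈ C₁, u < r₂ → (u, r₂) ∈ E := by
    intro u hu hlt
    simp only [hE, Finset.mem_filter, Finset.mem_offDiag]
    exact ⟨⟨π.mem_Icc hC₁ hu, π.mem_Icc hC₂ hr₂, hlt.ne⟩, hlt⟩
  have hzero : ∑ e ∈ E, a.1 e *
      ((if e = (r₁, r₂) then 2 else 0) - (if e = (i, r₂) then 2 else 0)) = 0 := by
    have hsum : ∑ e ∈ E, a.1 e *
        ((if e = (r₁, r₂) then 2 else 0) - (if e = (i, r₂) then 2 else 0)) =
        dotP n a (charVec n K π₁) - dotP n a (charVec n K π₃) - dotP n a (charVec n K π₂) +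
          dotP n a (charVec n K π₄) := by
      have hedge : ∀ e ∈ E, a.1 e *
          ((if e = (r₁, r₂) then 2 else 0) - (if e = (i, r₂) then 2 else 0)) =
          a.1 e * (charVec n K π₁).1 e - a.1 e * (charVec n K π₃).1 e -
            a.1 e * (charVec n K π₂).1 e + a.1 e * (charVec n K π₄).1 e := by
        rintro ⟨u, v⟩ he
        rw [← hcoef u v (Finset.mem_filter.mp he).2]
        ring
      rw [Finset.sum_congr rfl hedge]
      simp only [dotP, hrep₁₃, hrep₂₄, Finset.sum_add_distrib, Finset.sum_sub_distrib, ← hE]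
      ring
    rw [hsum, hπ₁, hπ₂, hπ₃, hπ₄]
    ring
  simp only [mul_sub, mul_ite, mul_zero, Finset.sum_sub_distrib, Finset.sum_ite_eq',
    hmem r₁ hr₁ hr₁r₂, hmem i hi hir₂, if_true] at hzero
  rw [hsym r₂ i]
  linarith
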